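/- arXiv:1504.06118 — 11 statements merged into one kernel-verified Lean document; each statement's English description precedes it below -/
import Mathlib

section
/- For all real numbers a and b, the Godunov flux satisfies ĥ(a,b) = f_∞ if and only if either (a = u_L and b ≥ u_R) or (a ≤ u_L and b = u_R). -/
/-- The Godunov numerical flux associated with a physical flux `f`:
`ĥ(a,b) = min {f(v) : v ∈ [a,b]}` if `a ≤ b` and `ĥ(a,b) = max {f(v) : v ∈ [b,a]}`
if `a > b`. -/
noncomputable def godunovFlux (f : ℝ → ℝ) (a b : ℝ) : ℝ :=
  if a ≤ b then sInf (f '' Set.Icc a b) else sSup (f '' Set.Icc b a)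

/-- On a nonempty closed interval the Godunov flux of a continuous `f` is an attained minimum. -/
theorem godunovFlux_eq_iff_isLeast {f : ℝ → ℝ} (hf : Continuous f) {a b c : ℝ} (hab : a ≤ b) :
    godunovFlux f a b = c ↔ IsLeast (f '' Set.Icc a b) c := by
  have h : IsLeast (f '' Set.Icc a b) (godunovFlux f a b) := by
    rw [godunovFlux, if_pos hab]
    exact (isCompact_Icc.image hf).isLeast_sInf ((Set.nonempty_Icc.2 hab).image f)
  exact ⟨fun e => e ▸ h, fun hc => h.unique hc⟩

/-- For decreasing data the Godunov flux of a continuous `f` is an attained maximum. -/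
theorem godunovFlux_eq_iff_isGreatest {f : ℝ → ℝ} (hf : Continuous f) {a b c : ℝ} (hba : b < a) :
    godunovFlux f a b = c ↔ IsGreatest (f '' Set.Icc b a) c := by
  have h : IsGreatest (f '' Set.Icc b a) (godunovFlux f a b) := by
    rw [godunovFlux, if_neg hba.not_ge]
    exact (isCompact_Icc.image hf).isGreatest_sSup ((Set.nonempty_Icc.2 hba.le).image f)
  exact ⟨fun e => e ▸ h, fun hc => h.unique hc⟩

theorem StrictConvexOn.lt_of_mem_Ioo_of_eq {f : ℝ → ℝ} (hconv : StrictConvexOn ℝ Set.univ f)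
    {x y z c : ℝ} (hx : f x = c) (hz : f z = c) (hxy : x < y) (hyz : y < z) : f y < c := by
  have h := hconv.lt_on_openSegment (Set.mem_univ x) (Set.mem_univ z) (hxy.trans hyz).ne
    (openSegment_eq_Ioo (hxy.trans hyz) ▸ ⟨hxy, hyz⟩ : y ∈ openSegment ℝ x z)
  rwa [hx, hz, max_self] at h

theorem StrictConvexOn.lt_of_eq_of_lt_right {f : ℝ → ℝ} (hconv : StrictConvexOn ℝ Set.univ f)
    {x y z c : ℝ} (hx : f x = c) (hy : f y = c) (hxy : x < y) (hyz : y < z) : c < f z := by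
  have h := hconv.slope_strict_mono_adjacent (Set.mem_univ x) (Set.mem_univ z) hxy hyz
  rw [hx, hy, sub_self, zero_div, lt_div_iff₀ (sub_pos.2 hyz)] at h
  linarith

theorem StrictConvexOn.lt_of_eq_of_lt_left {f : ℝ → ℝ} (hconv : StrictConvexOn ℝ Set.univ f)
    {x y z c : ℝ} (hy : f y = c) (hz : f z = c) (hxy : x < y) (hyz : y < z) : c < f x := by
  have h := hconv.slope_strict_mono_adjacent (Set.mem_univ x) (Set.mem_univ z) hxy hyz
  rw [hy, hz, sub_self, zero_div, div_lt_iff₀ (sub_pos.2 hxy)] at h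
  linarith

/-- For a continuous, strictly convex and coercive flux `f` with states
`u_R < u_L`, `f(u_L) = f(u_R) = f_∞`, the Godunov flux satisfies
`ĥ(a,b) = f_∞` iff `(a = u_L ∧ b ≥ u_R)` or `(a ≤ u_L ∧ b = u_R)`. -/
theorem stmt2 (f : ℝ → ℝ) (hf : Continuous f) (hconv : StrictConvexOn ℝ Set.univ f)
    (hcoTop : Filter.Tendsto f Filter.atTop Filter.atTop)
    (hcoBot : Filter.Tendsto f Filter.atBot Filter.atTop)
    (uL uR finf : ℝ) (hLR : uR < uL) (hfL : f uL = finf) (hfR : f uR = finf) :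
    ∀ a b : ℝ, godunovFlux f a b = finf ↔ ((a = uL ∧ uR ≤ b) ∨ (a ≤ uL ∧ b = uR)) := by
  intro a b
  have inside : ∀ v, uR < v → v < uL → f v < finf := fun v h₁ h₂ =>
    hconv.lt_of_mem_Ioo_of_eq hfR hfL h₁ h₂
  have right : ∀ v, uL < v → finf < f v := fun v h =>
    hconv.lt_of_eq_of_lt_right hfR hfL hLR h
  have left : ∀ v, v < uR → finf < f v := fun v h =>
    hconv.lt_of_eq_of_lt_left hfR hfL h hLR
  have level : ∀ v, f v = finf → v = uR ∨ v = uL := by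
    intro v hv
    by_contra! hne
    rcases lt_or_gt_of_ne hne.1 with h | h
    · exact (left v h).ne' hv
    · rcases lt_or_gt_of_ne hne.2 with h' | h'
      · exact (inside v h h').ne hv
      · exact (right v h').ne' hv
  have outer_ge : ∀ v, v ≤ uR ∨ uL ≤ v → finf ≤ f v := by
    rintro v (h | h)
    · rcases h.eq_or_lt with rfl | h
      exacts [hfR.ge, (left v h).le]
    · rcases h.eq_or_lt with rfl | h
      exacts [hfL.ge, (right v h).le]
  have inner_le : ∀ v, uR ≤ v → v ≤ uL → f v ≤ finf := by
    intro v h h'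
    rcases h.eq_or_lt with rfl | h
    · exact hfR.le
    · rcases h'.eq_or_lt with rfl | h'
      exacts [hfL.le, (inside v h h').le]
  rcases le_or_gt a b with hab | hba
  · rw [godunovFlux_eq_iff_isLeast hf hab]
    constructor
    · rintro ⟨⟨v, ⟨hav, hvb⟩, hv⟩, hlow⟩
      have hmin : ∀ w, a ≤ w → w ≤ b → finf ≤ f w := fun w h₁ h₂ => hlow ⟨w, ⟨h₁, h₂⟩, rfl⟩
      rcases level v hv with rfl | rfl
      · refine Or.inr ⟨hav.trans hLR.le, ?_⟩
        by_contra hne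
        obtain ⟨w, hw, hw'⟩ := exists_between (lt_min (lt_of_le_of_ne hvb (Ne.symm hne)) hLR)
        obtain ⟨hwb, hwL⟩ := lt_min_iff.1 hw'
        exact (inside w hw hwL).not_ge (hmin w (hav.trans hw.le) hwb.le)
      · refine Or.inl ⟨?_, hLR.le.trans hvb⟩
        by_contra hne
        obtain ⟨w, hw', hw⟩ := exists_between (max_lt (lt_of_le_of_ne hav hne) hLR)
        obtain ⟨haw, hRw⟩ := max_lt_iff.1 hw'
        exact (inside w hRw hw).not_ge (hmin w haw.le (hw.le.trans hvb))
    · rintro (⟨rfl, -⟩ | ⟨-, rfl⟩)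
      · refine ⟨⟨a, ⟨le_rfl, hab⟩, hfL⟩, ?_⟩
        rintro _ ⟨w, hw, rfl⟩
        exact outer_ge w (Or.inr hw.1)
      · refine ⟨⟨b, ⟨hab, le_rfl⟩, hfR⟩, ?_⟩
        rintro _ ⟨w, hw, rfl⟩
        exact outer_ge w (Or.inl hw.2)
  · rw [godunovFlux_eq_iff_isGreatest hf hba]
    constructor
    · rintro ⟨⟨v, ⟨hbv, hva⟩, hv⟩, hup⟩
      have haL : a ≤ uL := not_lt.1 fun h => (right a h).not_ge (hup ⟨a, ⟨hba.le, le_rfl⟩, rfl⟩)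
      have hRb : uR ≤ b := not_lt.1 fun h => (left b h).not_ge (hup ⟨b, ⟨le_rfl, hba.le⟩, rfl⟩)
      rcases level v hv with rfl | rfl
      · exact Or.inr ⟨haL, hbv.antisymm hRb⟩
      · exact Or.inl ⟨haL.antisymm hva, hRb⟩
    · rintro (⟨rfl, hRb⟩ | ⟨haL, rfl⟩)
      · refine ⟨⟨a, ⟨hba.le, le_rfl⟩, hfL⟩, ?_⟩
        rintro _ ⟨w, hw, rfl⟩
        exact inner_le w (hRb.trans hw.1) hw.2
      · refine ⟨⟨b, ⟨le_rfl, hba.le⟩, hfR⟩, ?_⟩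
        rintro _ ⟨w, hw, rfl⟩
        exact inner_le w hw.1 (hw.2.trans haL)
end

section
/- For every integer p ≥ 0 and every real number c, the (p+1)×(p+1) real matrix A with entries A_{0,l} = c for all 0 ≤ l ≤ p and, for 1 ≤ k ≤ p, A_{k,l} = c·(1 − (−1)^{k+l}) if l < k and A_{k,l} = 0 if l ≥ k, has determinant det A = (−2)^p · c^{p+1}. -/
/-- The `(p+1) × (p+1)` matrix with first row constant equal to `c` and, for rows
`1 ≤ k ≤ p`, entries `c (1 - (-1)^{k+l})` for `l < k` and `0` for `l ≥ k`, has
determinant `(-2)^p c^{p+1}`. -/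
theorem stmt3 (p : ℕ) (c : ℝ) :
    (Matrix.of fun k l : Fin (p+1) =>
      if (k : ℕ) = 0 then c
      else if (l : ℕ) < (k : ℕ) then c * (1 - (-1:ℝ)^((k : ℕ)+(l : ℕ))) else 0).det
      = (-2:ℝ)^p * c^(p+1) := by
  rw [Matrix.det_succ_column _ (Fin.last p), Fin.sum_univ_succ, Finset.sum_eq_zero, add_zero]
  · rw [Matrix.det_of_isLowerTriangular]
    · have h (i : Fin p) : (-1 : ℝ) ^ ((i : ℕ) + 1 + i) = -1 :=
        Odd.neg_one_pow ⟨i, by ring⟩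
      simp only [Fin.val_zero, Fin.val_last, zero_add, Matrix.of_apply, Matrix.submatrix_apply,
        Fin.zero_succAbove, Fin.succAbove_last, Fin.val_succ, Fin.val_castSucc, h,
        Nat.add_one_ne_zero, if_true, if_false, Nat.lt_succ_self, Finset.prod_const,
        Finset.card_univ, Fintype.card_fin]
      rw [show (-2 : ℝ) = -1 * 2 by norm_num, mul_pow, mul_pow]
      ring
    · intro i j hij
      have hij' : i < j := hij
      simp only [Matrix.submatrix_apply, Matrix.of_apply, Fin.zero_succAbove, Fin.succAbove_last,
        Fin.val_succ, Fin.val_castSucc, Nat.add_one_ne_zero, if_false]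
      rw [if_neg (by omega)]
  · intro i _
    have hi : ¬ Fin.last p < i.succ := not_lt.mpr (Fin.le_last _)
    simp [hi]
end

section
/- For every integer p ≥ 0 and every real number c, the (p+1)×(p+1) real matrix B with entries B_{0,l} = (−1)^l c for all 0 ≤ l ≤ p and, for 1 ≤ k ≤ p, B_{k,l} = c·(1 − (−1)^{k+l}) if l < k and B_{k,l} = 0 if l ≥ k, has determinant det B = 2^p · c^{p+1}. -/
/-- The `(p+1) × (p+1)` matrix with first row `((-1)^l c)_{0 ≤ l ≤ p}` and, for rows
`1 ≤ k ≤ p`, entries `c (1 - (-1)^{k+l})` for `l < k` and `0` for `l ≥ k`, has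
determinant `2^p c^{p+1}`. -/
theorem stmt4 (p : ℕ) (c : ℝ) :
    (Matrix.of fun k l : Fin (p+1) =>
      if (k : ℕ) = 0 then (-1:ℝ)^(l : ℕ) * c
      else if (l : ℕ) < (k : ℕ) then c * (1 - (-1:ℝ)^((k : ℕ)+(l : ℕ))) else 0).det
      = (2:ℝ)^p * c^(p+1) := by
  rw [Matrix.det_succ_column _ (Fin.last p), Fin.sum_univ_succ, Finset.sum_eq_zero, add_zero]
  · rw [Matrix.det_of_isLowerTriangular]
    · have hdiag (i : Fin p) : (1 : ℝ) - (-1) ^ ((i : ℕ) + 1 + i) = 2 := by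
        rw [show (i : ℕ) + 1 + i = 2 * i + 1 by ring, pow_succ, pow_mul]
        norm_num
      have hsign : (-1 : ℝ) ^ p * (-1) ^ p = 1 := by
        rw [← mul_pow]
        norm_num
      simp only [Matrix.submatrix_apply, Matrix.of_apply, Fin.succAbove_zero, Fin.succAbove_last,
        Fin.val_succ, Fin.val_castSucc, Fin.val_zero, Fin.val_last, Nat.succ_ne_zero, if_true,
        if_false, Nat.lt_succ_self, hdiag, Finset.prod_const, Finset.card_univ, Fintype.card_fin,
        zero_add, mul_pow]
      linear_combination c ^ (p + 1) * 2 ^ p * hsign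
    · intro i j hij
      have hij' : (i : ℕ) < j := hij
      have hle : ¬ j ≤ i := by omega
      simp [hle]
  · intro i _
    have hle : ¬ Fin.last p < i.succ := (Fin.le_last _).not_gt
    simp [hle]
end

section
/- Let f : ℝ → ℝ be twice continuously differentiable, let u_L ∈ ℝ with f'(u_L) > 0, set f_∞ = f(u_L), and let p ≥ 0 be an integer. Define G : ℝ^{p+1} → ℝ^{p+1} by G^0(U) = f(∑_{l=0}^{p} U_l) − f_∞ and, for 1 ≤ k ≤ p, G^k(U) = ∫_{-1}^{1} f(∑_{l=0}^{p} U_l L_l(s)) · L_k'(s) ds − (1 − (−1)^k) f_∞. Then there exists an open neighborhood of the point U_L = (u_L, 0, …, 0) in ℝ^{p+1} in which U_L is the unique zero of G. -/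
/-- The Legendre polynomials on `[-1,1]`, defined by `L 0 = 1`, `L 1 = id` and the
Bonnet recurrence `(k+1) L_{k+1}(s) = (2k+1) s L_k(s) - k L_{k-1}(s)`. -/
noncomputable def legendre : ℕ → ℝ → ℝ
  | 0, _ => 1
  | 1, s => s
  | (k+2), s =>
      ((2 * (k : ℝ) + 3) * s * legendre (k+1) s - ((k : ℝ) + 1) * legendre k s) / ((k : ℝ) + 2)

open Polynomial in
/-- The Legendre polynomials as elements of `ℝ[X]`. -/
noncomputable def legendrePoly : ℕ → ℝ[X]
  | 0 => 1
  | 1 => X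
  | (k+2) => C (((k : ℝ) + 2)⁻¹) *
      (C (2 * (k : ℝ) + 3) * X * legendrePoly (k+1) - C ((k : ℝ) + 1) * legendrePoly k)

open Polynomial in
theorem eval_legendrePoly (n : ℕ) (s : ℝ) : (legendrePoly n).eval s = legendre n s := by
  induction n using Nat.twoStepInduction with
  | zero => simp [legendrePoly, legendre]
  | one => simp [legendrePoly, legendre]
  | more k h0 h1 =>
    simp only [legendrePoly, legendre, eval_mul, eval_sub, eval_C, eval_X, h0, h1]
    ring

theorem legendre_eq_eval (n : ℕ) : legendre n = fun s => (legendrePoly n).eval s :=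
  funext fun s => (eval_legendrePoly n s).symm

theorem deriv_legendre (n : ℕ) (s : ℝ) :
    deriv (legendre n) s = (Polynomial.derivative (legendrePoly n)).eval s := by
  rw [legendre_eq_eval, Polynomial.deriv]

theorem degree_legendrePoly (n : ℕ) : (legendrePoly n).degree = n := by
  induction n using Nat.twoStepInduction with
  | zero => simp [legendrePoly]
  | one => simp [legendrePoly]
  | more k h0 h1 =>
    have hk : ((k : ℝ) + 2)⁻¹ ≠ 0 := by positivity
    have hk' : 2 * (k : ℝ) + 3 ≠ 0 := by positivity
    have hk'' : (k : ℝ) + 1 ≠ 0 := by positivity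
    have e1 : (Polynomial.C (2 * (k : ℝ) + 3) * Polynomial.X * legendrePoly (k+1)).degree
        = ((k + 2 : ℕ) : WithBot ℕ) := by
      rw [Polynomial.degree_mul, Polynomial.degree_C_mul_X hk', h1]
      norm_cast
      omega
    rw [legendrePoly, Polynomial.degree_C_mul hk, Polynomial.degree_sub_eq_left_of_degree_lt, e1]
    rw [e1, Polynomial.degree_C_mul hk'', h0]
    norm_cast
    omega

theorem legendre_one (n : ℕ) : legendre n 1 = 1 := by
  induction n using Nat.twoStepInduction with
  | zero => simp [legendre]
  | one => simp [legendre]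
  | more k h0 h1 =>
    rw [legendre, h0, h1, div_eq_one_iff_eq (by positivity)]
    ring

theorem legendre_neg_one (n : ℕ) : legendre n (-1) = (-1) ^ n := by
  induction n using Nat.twoStepInduction with
  | zero => simp [legendre]
  | one => simp [legendre]
  | more k h0 h1 =>
    rw [legendre, h0, h1, div_eq_iff (by positivity)]
    ring

theorem continuous_legendre (n : ℕ) : Continuous (legendre n) := by
  rw [legendre_eq_eval]
  exact (legendrePoly n).continuous

theorem continuous_deriv_legendre (n : ℕ) : Continuous (deriv (legendre n)) := by
  rw [funext (deriv_legendre n)]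
  exact Polynomial.continuous _

theorem integral_deriv_legendre (n : ℕ) :
    ∫ s in (-1:ℝ)..1, deriv (legendre n) s = 1 - (-1) ^ n := by
  rw [intervalIntegral.integral_deriv_eq_sub, legendre_one, legendre_neg_one]
  · intro s _
    rw [legendre_eq_eval]
    exact Polynomial.differentiableAt _
  · exact (continuous_deriv_legendre n).intervalIntegrable _ _

/-- A subspace containing a polynomial of each degree below `n` contains all polynomials of degree
below `n`. -/
theorem Polynomial.mem_submodule_of_degree_lt {K : Type*} [Field K] (S : Submodule K (Polynomial K))
    (P : ℕ → Polynomial K) (n : ℕ) (hP : ∀ k < n, (P k).degree = k) (hS : ∀ k < n, P k ∈ S)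
    {q : Polynomial K} (hq : q.degree < n) : q ∈ S := by
  induction n generalizing q with
  | zero =>
    have : q = 0 := by simpa using hq
    simp [this]
  | succ n ih =>
    have hPn := hP n n.lt_succ_self
    have hPc : (P n).coeff n ≠ 0 := coeff_ne_zero_of_eq_degree hPn
    have hlt : (q - (q.coeff n / (P n).coeff n) • P n).degree < n := by
      rw [degree_lt_iff_coeff_zero] at hq ⊢
      intro m hm
      rcases hm.eq_or_lt with rfl | hm
      · simp [hPc]
      · have : (P n).coeff m = 0 := coeff_eq_zero_of_degree_lt (by rw [hPn]; exact_mod_cast hm)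
        simp [this, hq m hm]
    have := ih (fun k hk => hP k (by omega)) (fun k hk => hS k (by omega)) hlt
    simpa using S.add_mem this (S.smul_mem (q.coeff n / (P n).coeff n) (hS n n.lt_succ_self))

theorem degree_derivative_legendrePoly (n : ℕ) :
    (Polynomial.derivative (legendrePoly (n + 1))).degree = n := by
  have h : (legendrePoly (n + 1)).natDegree = n + 1 :=
    Polynomial.natDegree_eq_of_degree_eq_some (degree_legendrePoly _)
  rw [Polynomial.degree_derivative (by omega), h]
  simp

/-- A continuous function whose moments against `L_1', …, L_p'` vanish is orthogonal to all
polynomials of degree below `p`. -/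
theorem integral_mul_eval_eq_zero_of_deriv_legendre {g : ℝ → ℝ} (hg : Continuous g) {p : ℕ}
    (h : ∀ k < p, ∫ s in (-1:ℝ)..1, g s * deriv (legendre (k + 1)) s = 0)
    {q : Polynomial ℝ} (hq : q.degree < p) : ∫ s in (-1:ℝ)..1, g s * q.eval s = 0 := by
  have hi (r : Polynomial ℝ) :
      IntervalIntegrable (fun s => g s * r.eval s) MeasureTheory.volume (-1) 1 :=
    (hg.mul r.continuous).intervalIntegrable _ _
  let S : Submodule ℝ (Polynomial ℝ) :=
    { carrier := {r | ∫ s in (-1:ℝ)..1, g s * r.eval s = 0}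
      zero_mem' := by simp
      add_mem' := by
        intro a b ha hb
        simp only [Set.mem_ofPred_eq, Polynomial.eval_add, mul_add] at ha hb ⊢
        rw [intervalIntegral.integral_add (hi a) (hi b), ha, hb, add_zero]
      smul_mem' := by
        intro c a ha
        simp only [Set.mem_ofPred_eq, Polynomial.eval_smul, smul_eq_mul, mul_left_comm] at ha ⊢
        rw [intervalIntegral.integral_const_mul, ha, mul_zero] }
  refine Polynomial.mem_submodule_of_degree_lt S
    (fun k => Polynomial.derivative (legendrePoly (k + 1))) p
    (fun k _ => degree_derivative_legendrePoly k) (fun k hk => ?_) hq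
  change ∫ s in (-1:ℝ)..1, g s * _ = 0
  simpa only [deriv_legendre] using h k hk

theorem linearIndependent_legendrePoly : LinearIndependent ℝ legendrePoly :=
  (Polynomial.Sequence.mk legendrePoly degree_legendrePoly).linearIndependent

theorem exists_strictMonoOn_ball_of_deriv_pos {f : ℝ → ℝ} (hf : ContDiff ℝ 1 f) {a : ℝ}
    (ha : 0 < deriv f a) : ∃ δ > 0, StrictMonoOn f (Metric.ball a δ) := by
  obtain ⟨δ, hδ, h⟩ := Metric.eventually_nhds_iff_ball.1
    ((hf.continuous_deriv le_rfl).continuousAt.eventually (lt_mem_nhds ha))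
  refine ⟨δ, hδ, strictMonoOn_of_deriv_pos (convex_ball a δ) hf.continuous.continuousOn ?_⟩
  rw [Metric.isOpen_ball.interior_eq]
  exact h

/-- If `v` is a polynomial of degree at most `p` close to `a` on `[-1,1]`, with `v(1) = a`, and
`f ∘ v - f a` is orthogonal to `L_1', …, L_p'`, where `f` is strictly increasing near `a`, then
`v` is constant: test with `(v - a) / (1 - s)`. -/
theorem eq_C_of_integral_deriv_legendre_eq_zero {f : ℝ → ℝ} (hf : Continuous f) {a : ℝ}
    {B : Set ℝ} (hB : StrictMonoOn f B) (haB : a ∈ B) {p : ℕ} {v : Polynomial ℝ}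
    (hv : v.degree < (p + 1 : ℕ)) (hvB : ∀ s ∈ Set.Icc (-1:ℝ) 1, v.eval s ∈ B)
    (hv1 : v.eval 1 = a)
    (h : ∀ k < p, ∫ s in (-1:ℝ)..1, (f (v.eval s) - f a) * deriv (legendre (k + 1)) s = 0) :
    v = Polynomial.C a := by
  obtain ⟨w, hw⟩ : Polynomial.X - Polynomial.C 1 ∣ v - Polynomial.C a := by
    rw [Polynomial.dvd_iff_isRoot]
    simp [hv1]
  have hwe (s : ℝ) : v.eval s - a = (s - 1) * w.eval s := by
    simpa using congrArg (Polynomial.eval s) hw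
  have hwd : w.degree < p := by
    have h1 : (v - Polynomial.C a).degree < (p + 1 : ℕ) :=
      (Polynomial.degree_sub_le _ _).trans_lt (max_lt hv
        (Polynomial.degree_C_le.trans_lt (by exact_mod_cast p.succ_pos)))
    rcases eq_or_ne w 0 with rfl | hw0
    · simp
    · rw [hw, Polynomial.degree_mul, Polynomial.degree_X_sub_C,
        Polynomial.degree_eq_natDegree hw0] at h1
      rw [Polynomial.degree_eq_natDegree hw0]
      norm_cast at h1 ⊢
      omega
  have hg : Continuous fun s => f (v.eval s) - f a :=
    (hf.comp v.continuous).sub continuous_const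
  have hint := integral_mul_eval_eq_zero_of_deriv_legendre hg h
    (q := -w) (by rwa [Polynomial.degree_neg])
  have hsign : ∀ s ∈ Set.Ico (-1:ℝ) 1, v.eval s ≠ a →
      0 < (f (v.eval s) - f a) * (-w).eval s := by
    intro s hs hne
    have hvs := hvB s ⟨hs.1, hs.2.le⟩
    have h1s : 0 < 1 - s := sub_pos.2 hs.2
    have hws : (1 - s) * (-w).eval s = v.eval s - a := by
      rw [hwe, Polynomial.eval_neg]; ring
    rcases hne.lt_or_gt with hlt | hlt
    · have := hB hvs haB hlt
      exact mul_pos_of_neg_of_neg (by linarith) (by nlinarith)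
    · have := hB haB hvs hlt
      exact mul_pos (by linarith) (pos_of_mul_pos_right (by linarith) h1s.le)
  have hconst : ∀ s ∈ Set.Ico (-1:ℝ) 1, v.eval s = a := by
    intro s hs
    by_contra hne
    refine (intervalIntegral.integral_pos (by norm_num) (hg.mul (-w).continuous).continuousOn
      (fun t ht => ?_) ⟨s, ⟨hs.1, hs.2.le⟩, hsign s hs hne⟩).ne' hint
    by_cases hta : v.eval t = a
    · simp [hta]
    · have ht1 : t ≠ 1 := fun h => hta (h ▸ hv1)
      exact (hsign t ⟨ht.1.le, lt_of_le_of_ne ht.2 ht1⟩ hta).le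
  refine Polynomial.eq_of_infinite_eval_eq _ _
    ((Set.Ico_infinite (a := (-1 : ℝ)) (b := 1) (by norm_num)).mono ?_)
  intro s hs
  simpa using hconst s hs

/-- Local uniqueness of the uniform supersonic discrete solution: if `f` is `C²`
with `f'(u_L) > 0` and `f_∞ = f(u_L)`, then the point `U_L = (u_L, 0, …, 0)` is the
unique zero, in a sufficiently small open neighborhood, of the stationary DG
residual map `G` with upwind flux:
`G^0(U) = f(∑_l U_l) - f_∞` and, for `1 ≤ k ≤ p`,
`G^k(U) = ∫_{-1}^1 f(∑_l U_l L_l(s)) L_k'(s) ds - (1 - (-1)^k) f_∞`. -/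
theorem stmt5 (f : ℝ → ℝ) (hf : ContDiff ℝ 2 f) (uL : ℝ) (hL : 0 < deriv f uL) (p : ℕ) :
    ∃ V : Set (Fin (p+1) → ℝ), IsOpen V ∧ (fun i => if i = 0 then uL else 0) ∈ V ∧
      ∀ U ∈ V,
        ((∀ k : Fin (p+1),
            (if (k : ℕ) = 0 then f (∑ l, U l) - f uL
             else (∫ s in (-1:ℝ)..1,
                    f (∑ l, U l * legendre (l : ℕ) s) * deriv (legendre (k : ℕ)) s)
                  - (1 - (-1:ℝ)^(k : ℕ)) * f uL) = 0)
          ↔ U = fun i => if i = 0 then uL else 0) := by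
  obtain ⟨δ, hδ, hmono⟩ := exists_strictMonoOn_ball_of_deriv_pos (hf.of_le one_le_two) hL
  have huL := Metric.mem_ball_self (x := uL) hδ
  have hbase (s : ℝ) :
      ∑ l : Fin (p+1), (if l = 0 then uL else 0) * legendre (l : ℕ) s = uL := by
    simp [legendre]
  have hcont : Continuous fun x : (Fin (p+1) → ℝ) × ℝ =>
      ∑ l, x.1 l * legendre (l : ℕ) x.2 := by
    have := continuous_legendre
    fun_prop
  have hev : ∀ᶠ U in nhds (fun i : Fin (p+1) => if i = 0 then uL else 0),
      ∀ s ∈ Set.Icc (-1:ℝ) 1, ∑ l : Fin (p+1), U l * legendre (l : ℕ) s ∈ Metric.ball uL δ := by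
    refine isCompact_Icc.eventually_forall_of_forall_eventually fun s _ => ?_
    refine hcont.continuousAt.eventually (Metric.isOpen_ball.mem_nhds ?_)
    simpa only [hbase] using huL
  obtain ⟨V, hV, hVo, hmem⟩ := eventually_nhds_iff.1 hev
  refine ⟨V, hVo, hmem, fun U hU => ⟨fun hG => ?_, ?_⟩⟩
  · set v : Polynomial ℝ := ∑ l : Fin (p+1), U l • legendrePoly l with hv
    have hve (s : ℝ) : v.eval s = ∑ l, U l * legendre (l : ℕ) s := by
      simp [hv, Polynomial.eval_finsetSum, eval_legendrePoly]
    have hvB : ∀ s ∈ Set.Icc (-1:ℝ) 1, v.eval s ∈ Metric.ball uL δ := by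
      simpa only [hve] using hV U hU
    have hvd : v.degree < (p + 1 : ℕ) := by
      refine (Polynomial.degree_sum_le _ _).trans_lt
        ((Finset.sup_lt_iff (WithBot.bot_lt_coe _)).2 fun l _ => ?_)
      refine (Polynomial.degree_smul_le _ _).trans_lt ?_
      rw [degree_legendrePoly]
      exact_mod_cast l.is_lt
    have hv1 : v.eval 1 = uL := by
      have h0 := hG 0
      refine hmono.injOn (hvB 1 (by simp)) huL ?_
      simpa [hve, legendre_one, sub_eq_zero] using h0
    have hvC : v = Polynomial.C uL := by
      refine eq_C_of_integral_deriv_legendre_eq_zero hf.continuous hmono huL hvd hvB hv1 ?_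
      intro k hk
      have hk1 := hG ⟨k + 1, by omega⟩
      have hd := continuous_deriv_legendre (k + 1)
      simp only [Nat.add_eq_zero_iff, one_ne_zero, and_false, if_false, ← hve] at hk1
      simp only [sub_mul]
      rw [intervalIntegral.integral_sub, intervalIntegral.integral_const_mul,
        integral_deriv_legendre]
      · linarith
      · exact ((hf.continuous.comp v.continuous).mul hd).intervalIntegrable _ _
      · exact (continuous_const.mul hd).intervalIntegrable _ _
    have hli := linearIndependent_legendrePoly.comp _ (Fin.val_injective (n := p + 1))
    refine hli.fintypeLinearCombination_injective ?_
    simp only [Fintype.linearCombination_apply, Function.comp_apply, ← hv, hvC]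
    simp [legendrePoly, Polynomial.smul_eq_C_mul]
  · rintro rfl k
    split_ifs with hk
    · simp
    · simp only [hbase]
      rw [intervalIntegral.integral_const_mul, integral_deriv_legendre]
      ring
end

section
/- Let f : ℝ → ℝ be continuous and strictly convex, let u_R < u_L with f(u_R) = f(u_L) = f_∞. Then: (i) for every real b ≤ u_L, ∫_{u_R}^{b} (f(v) − f_∞) dv = 0 if and only if b = u_R; and (ii) for every real a ≥ u_R, ∫_{a}^{u_L} (f(v) − f_∞) dv = 0 if and only if a = u_L. -/
/-- A strictly convex function on `ℝ` lies strictly below the larger of its endpoint values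
between two points. -/
theorem StrictConvexOn.lt_max_of_mem_Ioo {f : ℝ → ℝ} (hf : StrictConvexOn ℝ Set.univ f)
    {x y z : ℝ} (hz : z ∈ Set.Ioo x y) : f z < max (f x) (f y) := by
  have hxy : x < y := hz.1.trans hz.2
  refine hf.lt_on_openSegment (Set.mem_univ _) (Set.mem_univ _) hxy.ne ?_
  rwa [openSegment_eq_Ioo hxy]

theorem intervalIntegral_neg_of_neg_on {f : ℝ → ℝ} {a b : ℝ}
    (hf : IntervalIntegrable f MeasureTheory.volume a b) (hneg : ∀ x ∈ Set.Ioo a b, f x < 0)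
    (hab : a < b) : ∫ x in a..b, f x < 0 := by
  have := intervalIntegral.intervalIntegral_pos_of_pos_on hf.neg
    (fun x hx => neg_pos.2 (hneg x hx)) hab
  simpa [intervalIntegral.integral_neg] using this

/-- For a continuous, strictly convex flux `f` with `u_R < u_L` and
`f(u_R) = f(u_L) = f_∞`:
(i) for every `b ≤ u_L`, `∫_{u_R}^{b} (f(v) - f_∞) dv = 0 ↔ b = u_R`;
(ii) for every `a ≥ u_R`, `∫_{a}^{u_L} (f(v) - f_∞) dv = 0 ↔ a = u_L`. -/
theorem stmt8 (f : ℝ → ℝ) (hf : Continuous f) (hconv : StrictConvexOn ℝ Set.univ f)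
    (uR uL finf : ℝ) (hRL : uR < uL) (hfR : f uR = finf) (hfL : f uL = finf) :
    (∀ b : ℝ, b ≤ uL → ((∫ v in uR..b, (f v - finf)) = 0 ↔ b = uR)) ∧
    (∀ a : ℝ, uR ≤ a → ((∫ v in a..uL, (f v - finf)) = 0 ↔ a = uL)) := by
  have hint (a b : ℝ) : IntervalIntegrable (fun v => f v - finf) MeasureTheory.volume a b :=
    (hf.sub continuous_const).intervalIntegrable a b
  have hinside (v : ℝ) (hv : v ∈ Set.Ioo uR uL) : f v - finf < 0 := by
    have := hconv.lt_max_of_mem_Ioo hv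
    rw [hfR, hfL, max_self] at this
    linarith
  have hleft (v : ℝ) (hv : v < uR) : 0 < f v - finf := by
    have := hconv.lt_max_of_mem_Ioo ⟨hv, hRL⟩
    rw [hfR, hfL, lt_max_iff] at this
    simpa using this
  have hright (v : ℝ) (hv : uL < v) : 0 < f v - finf := by
    have := hconv.lt_max_of_mem_Ioo ⟨hRL, hv⟩
    rw [hfR, hfL, lt_max_iff] at this
    simpa using this
  refine ⟨fun b hb => ⟨fun h => ?_, ?_⟩, fun a ha => ⟨fun h => ?_, ?_⟩⟩
  · rcases lt_trichotomy b uR with hlt | heq | hgt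
    · have := intervalIntegral.intervalIntegral_pos_of_pos_on (hint b uR)
        (fun v hv => hleft v hv.2) hlt
      rw [intervalIntegral.integral_symm, h] at this
      simp at this
    · exact heq
    · exact absurd h (intervalIntegral_neg_of_neg_on (hint uR b)
        (fun v hv => hinside v ⟨hv.1, hv.2.trans_le hb⟩) hgt).ne
  · rintro rfl
    exact intervalIntegral.integral_same
  · rcases lt_trichotomy a uL with hlt | heq | hgt
    · exact absurd h (intervalIntegral_neg_of_neg_on (hint a uL)
        (fun v hv => hinside v ⟨ha.trans_lt hv.1, hv.2⟩) hlt).ne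
    · exact heq
    · have := intervalIntegral.intervalIntegral_pos_of_pos_on (hint uL a)
        (fun v hv => hright v hv.1) hgt
      rw [intervalIntegral.integral_symm, h] at this
      simp at this
  · rintro rfl
    exact intervalIntegral.integral_same
end

section
/- For every s_c ∈ (−2/3, 2/3), the unique pair (u_1, u_2) ∈ ℝ² satisfying s_c² + u_1²/3 + u_2²/5 = 1 and u_1·(s_c + (2/5) u_2) = 0, together with the strict trace inequalities s_c − u_1 + u_2 > −1 and s_c + u_1 + u_2 < 1, is u_1 = −√(3(1 − (9/4) s_c²)), u_2 = −(5/2) s_c. -/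
/-- The `p = 2` stationary DG shock profile for the Burgers equation, central
branch: for `s_c ∈ (-2/3, 2/3)`, the unique pair `(u_1, u_2)` with
`s_c² + u_1²/3 + u_2²/5 = 1`, `u_1 (s_c + (2/5) u_2) = 0`,
`s_c - u_1 + u_2 > -1` and `s_c + u_1 + u_2 < 1` is
`u_1 = -√(3(1 - (9/4) s_c²))`, `u_2 = -(5/2) s_c`. -/
theorem stmt10 (sc : ℝ) (hsc : sc ∈ Set.Ioo (-(2 : ℝ) / 3) (2 / 3)) (u1 u2 : ℝ) :
    (sc ^ 2 + u1 ^ 2 / 3 + u2 ^ 2 / 5 = 1 ∧ u1 * (sc + (2 / 5) * u2) = 0 ∧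
      sc - u1 + u2 > -1 ∧ sc + u1 + u2 < 1) ↔
      (u1 = -Real.sqrt (3 * (1 - (9 / 4) * sc ^ 2)) ∧ u2 = -(5 / 2) * sc) := by
  obtain ⟨hl, hr⟩ := hsc
  have hr0 : 0 < 3 * (1 - (9 / 4) * sc ^ 2) := by nlinarith
  constructor
  · rintro ⟨h1, h2, h3, h4⟩
    rcases mul_eq_zero.mp h2 with h | h
    · exfalso
      subst h
      have hs : 25 / 9 < u2 ^ 2 := by nlinarith
      have ha : u2 < 5 / 3 := by linarith
      have hb : -(5 / 3) < u2 := by linarith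
      nlinarith
    · have hu2 : u2 = -(5 / 2) * sc := by linarith
      subst hu2
      have hsq : 3 * (1 - (9 / 4) * sc ^ 2) = (-u1) ^ 2 := by nlinarith
      have hu1 : u1 ≤ 0 := by
        by_contra! hpos
        have ha : 0 < 1 - 3 / 2 * sc := by linarith
        have hb : 0 < 1 + 3 / 2 * sc := by linarith
        have hprod : u1 * u1 < (1 + 3 / 2 * sc) * (1 - 3 / 2 * sc) :=
          mul_lt_mul'' (by linarith) (by linarith) hpos.le hpos.le
        nlinarith [mul_pos ha hb]
      refine ⟨?_, rfl⟩
      rw [hsq, Real.sqrt_sq (neg_nonneg.mpr hu1), neg_neg]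
  · rintro ⟨rfl, rfl⟩
    have hs := Real.sq_sqrt hr0.le
    have hp := Real.sqrt_pos.mpr hr0
    refine ⟨?_, ?_, ?_, ?_⟩
    · rw [neg_sq, hs]
      ring
    · ring
    · linarith
    · linarith
end

section
/- For every s_c ∈ (−1, −2/3), the unique pair (u_1, u_2) ∈ ℝ² satisfying s_c² + u_1²/3 + u_2²/5 = 1 and u_1·(s_c + (2/5) u_2) = 0, together with the strict inequalities s_c − u_1 + u_2 > −1 and s_c + u_1 + u_2 < 1, is (u_1, u_2) = (0, √(5(1 − s_c²))); for every s_c ∈ (2/3, 1) the unique such pair is (u_1, u_2) = (0, −√(5(1 − s_c²))). -/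
/-- The profile conditions for a shock position left of `-2/3`. -/
theorem shock_profile_iff_of_lt {s u1 u2 : ℝ} (h₀ : -1 < s) (h₁ : s < -2 / 3) :
    (s ^ 2 + u1 ^ 2 / 3 + u2 ^ 2 / 5 = 1 ∧ u1 * (s + (2 / 5) * u2) = 0 ∧
      s - u1 + u2 > -1 ∧ s + u1 + u2 < 1) ↔
      (u1 = 0 ∧ u2 = Real.sqrt (5 * (1 - s ^ 2))) := by
  have hpos : 0 ≤ 5 * (1 - s ^ 2) := by nlinarith
  constructor
  · rintro ⟨hE, hP, hL, -⟩
    have hu1 : u1 = 0 := by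
      refine (mul_eq_zero.mp hP).resolve_right fun h ↦ ?_
      obtain rfl : u2 = -(5 / 2) * s := by linarith
      nlinarith [sq_nonneg u1]
    subst hu1
    have hu2 : 0 ≤ u2 := by
      by_contra! h
      nlinarith
    refine ⟨rfl, ?_⟩
    rw [eq_comm, Real.sqrt_eq_iff_eq_sq hpos hu2]
    linarith
  · rintro ⟨rfl, rfl⟩
    have hlt : Real.sqrt (5 * (1 - s ^ 2)) < 1 - s := by
      rw [Real.sqrt_lt' (by linarith)]
      nlinarith
    refine ⟨?_, by ring, ?_, by linarith⟩
    · rw [Real.sq_sqrt hpos]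
      ring
    · linarith [Real.sqrt_nonneg (5 * (1 - s ^ 2))]

/-- The `p = 2` stationary DG shock profile for the Burgers equation, interface
branches: for `s_c ∈ (-1, -2/3)`, the unique pair `(u_1, u_2)` satisfying
`s_c² + u_1²/3 + u_2²/5 = 1`, `u_1 (s_c + (2/5) u_2) = 0`,
`s_c - u_1 + u_2 > -1` and `s_c + u_1 + u_2 < 1` is `(0, √(5(1 - s_c²)))`;
for `s_c ∈ (2/3, 1)` it is `(0, -√(5(1 - s_c²)))`. -/
theorem stmt11 :
    (∀ sc ∈ Set.Ioo (-1 : ℝ) (-(2 : ℝ) / 3), ∀ u1 u2 : ℝ,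
      (sc ^ 2 + u1 ^ 2 / 3 + u2 ^ 2 / 5 = 1 ∧ u1 * (sc + (2 / 5) * u2) = 0 ∧
        sc - u1 + u2 > -1 ∧ sc + u1 + u2 < 1) ↔
        (u1 = 0 ∧ u2 = Real.sqrt (5 * (1 - sc ^ 2)))) ∧
    (∀ sc ∈ Set.Ioo ((2 : ℝ) / 3) 1, ∀ u1 u2 : ℝ,
      (sc ^ 2 + u1 ^ 2 / 3 + u2 ^ 2 / 5 = 1 ∧ u1 * (sc + (2 / 5) * u2) = 0 ∧
        sc - u1 + u2 > -1 ∧ sc + u1 + u2 < 1) ↔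
        (u1 = 0 ∧ u2 = -Real.sqrt (5 * (1 - sc ^ 2)))) := by
  refine ⟨fun s hs u1 u2 ↦ shock_profile_iff_of_lt hs.1 hs.2, fun s hs u1 u2 ↦ ?_⟩
  -- The reflection `(s, u1, u2) ↦ (-s, u1, -u2)` exchanges the two interfaces.
  have h := shock_profile_iff_of_lt (s := -s) (u1 := u1) (u2 := -u2)
    (by linarith [hs.2]) (by linarith [hs.1])
  rw [neg_sq, neg_sq, neg_eq_iff_eq_neg] at h
  rw [← h]
  constructor <;> rintro ⟨hE, hP, hL, hR⟩ <;>
    exact ⟨hE, by linarith, by linarith, by linarith⟩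
end

section
/- For every s_c ∈ (−1/6, 1/6), the triple (u_1, u_2, u_3) with u_1 = −(1/5)√(21/2)·√(5 − 54 s_c²), u_2 = −7 s_c, u_3 = −u_1 satisfies the system 1 − s_c² − u_1²/3 − u_2²/5 − u_3²/7 = 0, 2 u_1 (s_c + (2/5) u_2) + (18/35) u_2 u_3 = 0, 1 − s_c² − u_1² − (17/35) u_2² − u_3²/3 − 2 s_c u_2 − (6/7) u_1 u_3 = 0, together with the strict trace inequalities s_c − u_1 + u_2 − u_3 > −1 and s_c + u_1 + u_2 + u_3 < 1. -/
/-- The central branch of the `p = 3` stationary DG shock profile for the Burgers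
equation: for `s_c ∈ (-1/6, 1/6)`, the triple
`u_1 = -(1/5)√(21/2)√(5 - 54 s_c²)`, `u_2 = -7 s_c`, `u_3 = -u_1` satisfies the
three residual equations and the strict trace inequalities. -/
theorem stmt12 (sc : ℝ) (hsc : sc ∈ Set.Ioo (-(1 : ℝ) / 6) (1 / 6))
    (u1 u2 u3 : ℝ)
    (hu1 : u1 = -(1 / 5) * Real.sqrt (21 / 2) * Real.sqrt (5 - 54 * sc ^ 2))
    (hu2 : u2 = -7 * sc) (hu3 : u3 = -u1) :
    1 - sc ^ 2 - u1 ^ 2 / 3 - u2 ^ 2 / 5 - u3 ^ 2 / 7 = 0 ∧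
    2 * u1 * (sc + (2 / 5) * u2) + (18 / 35) * u2 * u3 = 0 ∧
    1 - sc ^ 2 - u1 ^ 2 - (17 / 35) * u2 ^ 2 - u3 ^ 2 / 3 - 2 * sc * u2
      - (6 / 7) * u1 * u3 = 0 ∧
    sc - u1 + u2 - u3 > -1 ∧ sc + u1 + u2 + u3 < 1 := by
  obtain ⟨h₁, h₂⟩ := hsc
  have hnonneg : 0 ≤ 5 - 54 * sc ^ 2 := by nlinarith
  have hsq : u1 ^ 2 = 21 / 50 * (5 - 54 * sc ^ 2) := by
    rw [hu1, mul_pow, mul_pow, Real.sq_sqrt (by norm_num), Real.sq_sqrt hnonneg]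
    ring
  clear hu1
  subst hu2 hu3
  refine ⟨?_, ?_, ?_, ?_, ?_⟩
  · linear_combination -(10 / 21) * hsq
  · ring
  · linear_combination -(10 / 21) * hsq
  · linarith
  · linarith
end

section
/- Let s_c ∈ ℝ and let (u_1, u_2, u_3) ∈ ℝ³ satisfy 1 − s_c² − u_1²/3 − u_2²/5 − u_3²/7 = 0, 2 u_1 (s_c + (2/5) u_2) + (18/35) u_2 u_3 = 0, and 1 − s_c² − u_1² − (17/35) u_2² − u_3²/3 − 2 s_c u_2 − (6/7) u_1 u_3 = 0, with u_2 ≠ 0 and u_2 + 3 s_c ≠ 0. Then u_3 = −7 u_1 (5 s_c + 2 u_2) / (9 u_2), 5 (u_2 + 3 s_c) u_1² = 3 u_2 (u_2²/35 + 3 s_c u_2 + 2(1 − s_c²)), and (7 s_c + u_2)·(4 u_2³ + 7 s_c u_2² + 14 s_c² u_2 − (7/2) u_2 + 7 s_c (1 − s_c²)) = 0. -/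
/-- Algebraic reduction of the `p = 3` stationary shock-cell system for the
Burgers equation: under the three residual equations, if `u_2 ≠ 0` and
`u_2 + 3 s_c ≠ 0`, then `u_3 = -7 u_1 (5 s_c + 2 u_2)/(9 u_2)`,
`5 (u_2 + 3 s_c) u_1² = 3 u_2 (u_2²/35 + 3 s_c u_2 + 2(1 - s_c²))`, and
`(7 s_c + u_2)(4 u_2³ + 7 s_c u_2² + 14 s_c² u_2 - (7/2) u_2 + 7 s_c (1 - s_c²)) = 0`. -/
theorem stmt13 (sc u1 u2 u3 : ℝ)
    (h1 : 1 - sc ^ 2 - u1 ^ 2 / 3 - u2 ^ 2 / 5 - u3 ^ 2 / 7 = 0)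
    (h2 : 2 * u1 * (sc + (2 / 5) * u2) + (18 / 35) * u2 * u3 = 0)
    (h3 : 1 - sc ^ 2 - u1 ^ 2 - (17 / 35) * u2 ^ 2 - u3 ^ 2 / 3 - 2 * sc * u2
        - (6 / 7) * u1 * u3 = 0)
    (hu2 : u2 ≠ 0) (hden : u2 + 3 * sc ≠ 0) :
    u3 = -7 * u1 * (5 * sc + 2 * u2) / (9 * u2) ∧
    5 * (u2 + 3 * sc) * u1 ^ 2 = 3 * u2 * (u2 ^ 2 / 35 + 3 * sc * u2 + 2 * (1 - sc ^ 2)) ∧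
    (7 * sc + u2) *
      (4 * u2 ^ 3 + 7 * sc * u2 ^ 2 + 14 * sc ^ 2 * u2 - (7 / 2) * u2
        + 7 * sc * (1 - sc ^ 2)) = 0 := by
  have hu3 : 9 * u2 * u3 = -7 * u1 * (5 * sc + 2 * u2) := by
    linear_combination (35 / 2) * h2
  have hu1 : 5 * (u2 + 3 * sc) * u1 ^ 2
      = 3 * u2 * (u2 ^ 2 / 35 + 3 * sc * u2 + 2 * (1 - sc ^ 2)) := by
    linear_combination (-9 / 2) * u2 * ((7 / 3) * h1 - h3) + (3 / 7) * u1 * hu3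
  refine ⟨?_, hu1, ?_⟩
  · rw [eq_div_iff (mul_ne_zero (by norm_num) hu2)]
    linear_combination hu3
  · have hsq : u2 ^ 2 * (1 - sc ^ 2 - u2 ^ 2 / 5)
        = u1 ^ 2 * (u2 ^ 2 / 3 + 7 * (5 * sc + 2 * u2) ^ 2 / 81) := by
      linear_combination u2 ^ 2 * h1
        + (9 * u2 * u3 - 7 * u1 * (5 * sc + 2 * u2)) / 567 * hu3
    apply (mul_eq_zero_iff_left hu2).mp
    linear_combination (-7 / 10) * (27 * (u2 + 3 * sc) * hsq
      + (27 * u2 ^ 2 + 7 * (5 * sc + 2 * u2) ^ 2) / 15 * hu1)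
end

section
/- Let s_c ∈ (−1, 1), u_L > 0 and λ > 0 be real numbers, and set u_h(s) = u_L (s_c − √(3(1 − s_c²)) s) for s ∈ [−1, 1]. Then the 2×2 matrix with entries T_{k,l} = δ_{k,l} + λ (2k+1) ∫_{-1}^{1} u_h(s) L_l(s) L_k'(s) ds for 0 ≤ k, l ≤ 1 equals [[1, 0], [6 λ u_L s_c, 1 − 2 λ u_L √(3(1 − s_c²))]], and its eigenvalues are 1 and 1 − 2 λ u_L √(3(1 − s_c²)). -/
theorem legendre_zero : legendre 0 = fun _ => 1 := by
  funext s
  rw [legendre]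

theorem legendre_one_s16 : legendre 1 = fun s => s := by
  funext s
  rw [legendre]

/-- The spectrum of a lower triangular `2 × 2` matrix is the set of its diagonal entries. -/
theorem Matrix.spectrum_fin_two_lowerTriangular {K : Type*} [Field K] (a b c : K) :
    spectrum K !![a, 0; b, c] = {a, c} := by
  ext x
  rw [spectrum.mem_iff, Matrix.isUnit_iff_isUnit_det, isUnit_iff_ne_zero, not_not,
    Matrix.det_fin_two]
  simp [Matrix.algebraMap_matrix_apply, sub_eq_zero]

theorem integral_linear_symm (b : ℝ) : ∫ s in (-1 : ℝ)..1, b * s = 0 := by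
  refine (intervalIntegral.integral_const_mul b fun s : ℝ => s).trans ?_
  simp

theorem integral_affine_symm (a b : ℝ) : ∫ s in (-1 : ℝ)..1, (a + b * s) = 2 * a := by
  rw [intervalIntegral.integral_add (by simp) (Continuous.intervalIntegrable (by fun_prop) _ _),
    integral_linear_symm, intervalIntegral.integral_const, smul_eq_mul]
  ring

theorem integral_affine_mul_id_symm (a b : ℝ) :
    ∫ s in (-1 : ℝ)..1, (a + b * s) * s = 2 / 3 * b := by
  have h : (fun s : ℝ => (a + b * s) * s) = fun s => a * s + b * s ^ 2 := by
    funext s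
    ring
  rw [h, intervalIntegral.integral_add (Continuous.intervalIntegrable (by fun_prop) _ _)
    (Continuous.intervalIntegrable (by fun_prop) _ _), integral_linear_symm]
  simp only [intervalIntegral.integral_const_mul, integral_pow]
  norm_num
  ring

/-- The `p = 1` shock-cell diagonal block of the linearized forward-Euler DG
scheme with Godunov flux around the `p = 1` discrete shock profile
`u_h(s) = u_L (s_c - √(3(1-s_c²)) s)` of the Burgers equation: the matrix
`T_{k,l} = δ_{k,l} + λ (2k+1) ∫_{-1}^1 u_h L_l L_k'` equals
`[[1, 0], [6 λ u_L s_c, 1 - 2 λ u_L √(3(1-s_c²))]]` and has eigenvalues `1` and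
`1 - 2 λ u_L √(3(1-s_c²))`. -/
theorem stmt16 (sc uL lam : ℝ) (hsc : sc ∈ Set.Ioo (-1 : ℝ) 1)
    (huL : 0 < uL) (hlam : 0 < lam)
    (uh : ℝ → ℝ) (huh : ∀ s, uh s = uL * (sc - Real.sqrt (3 * (1 - sc ^ 2)) * s))
    (T : Matrix (Fin 2) (Fin 2) ℝ)
    (hT : T = Matrix.of fun k l : Fin 2 =>
      (if k = l then (1 : ℝ) else 0) +
        lam * (2 * (k : ℕ) + 1) *
          ∫ s in (-1:ℝ)..1, uh s * legendre (l : ℕ) s * deriv (legendre (k : ℕ)) s) :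
    T = !![1, 0; 6 * lam * uL * sc, 1 - 2 * lam * uL * Real.sqrt (3 * (1 - sc ^ 2))] ∧
    spectrum ℝ T = {1, 1 - 2 * lam * uL * Real.sqrt (3 * (1 - sc ^ 2))} := by
  have hu : uh = fun s => uL * sc + -(uL * Real.sqrt (3 * (1 - sc ^ 2))) * s := by
    funext s
    rw [huh]
    ring
  have hT' : T = !![1, 0; 6 * lam * uL * sc,
      1 - 2 * lam * uL * Real.sqrt (3 * (1 - sc ^ 2))] := by
    rw [hT, hu]
    ext k l
    fin_cases k <;> fin_cases l
    · simp [legendre_zero]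
    · simp [legendre_zero]
    · simp only [Matrix.of_apply, Fin.mk_one, Fin.zero_eta, Fin.val_one, Fin.val_zero,
        legendre_zero, legendre_one_s16, deriv_id'', mul_one, integral_affine_symm]
      norm_num
      ring
    · simp only [Matrix.of_apply, Fin.mk_one, Fin.val_one,
        legendre_one_s16, deriv_id'', mul_one, integral_affine_mul_id_symm]
      norm_num
      ring
  exact ⟨hT', hT' ▸ Matrix.spectrum_fin_two_lowerTriangular _ _ _⟩
end

section
/- Let p ≥ 1 be an integer, let c be a nonzero real number, and let T be the (p+1)×(p+1) real matrix with entries T_{k,l} = δ_{k,l} + c (2k+1) N_{k,l}, where N_{k,l} = 1 − (−1)^{k+l} for k > l and N_{k,l} = 0 for k ≤ l. Then the characteristic polynomial of T is (X − 1)^{p+1} (so 1 is its only eigenvalue, with algebraic multiplicity p + 1), and the kernel of T − I is one-dimensional (so the eigenvalue 1 has geometric multiplicity 1 and T is not diagonalizable for p ≥ 1). -/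
open Polynomial

namespace Matrix

/-- The kernel of a strictly lower triangular matrix with nonvanishing subdiagonal is spanned by
the last standard basis vector. -/
theorem ker_toLin'_eq_span_of_subdiag_ne_zero {K : Type*} [Field K] {n : ℕ}
    {A : Matrix (Fin (n + 1)) (Fin (n + 1)) K} (hA : ∀ i j, i ≤ j → A i j = 0)
    (hsub : ∀ i : Fin n, A i.succ i.castSucc ≠ 0) :
    LinearMap.ker (toLin' A) = Submodule.span K {Pi.single (Fin.last n) 1} := by
  apply le_antisymm
  · intro v hv
    rw [LinearMap.mem_ker, toLin'_apply] at hv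
    have hzero : ∀ m : ℕ, ∀ i : Fin n, (i : ℕ) = m → v i.castSucc = 0 := by
      intro m
      induction m using Nat.strong_induction_on with
      | _ m ih =>
        intro i hi
        have hrow : ∑ j, A i.succ j * v j = 0 := congrFun hv i.succ
        rw [Finset.sum_eq_single i.castSucc] at hrow
        · exact (mul_eq_zero.mp hrow).resolve_left (hsub i)
        · intro j _ hj
          rcases lt_or_gt_of_ne hj with hlt | hgt
          · have hji : (j : ℕ) < i := hlt
            have hv0 := ih j (hi ▸ hji) ⟨j, hji.trans i.isLt⟩ rfl
            exact mul_eq_zero_of_right _ hv0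
          · rw [hA _ _ (Fin.castSucc_lt_iff_succ_le.mp hgt), zero_mul]
        · simp
    refine Submodule.mem_span_singleton.mpr ⟨v (Fin.last n), ?_⟩
    ext j
    refine Fin.lastCases ?_ (fun i => ?_) j
    · simp
    · simp [hzero i i rfl, (Fin.castSucc_lt_last i).ne]
  · rw [Submodule.span_singleton_le_iff_mem, LinearMap.mem_ker, toLin'_apply]
    ext i
    simp [hA i (Fin.last n) (Fin.le_last i)]

end Matrix

/-- The shock-cell diagonal block `T_{k,l} = δ_{k,l} + c (2k+1) N_{k,l}`
(with `N_{k,l} = 1 - (-1)^{k+l}` for `k > l`, `0` for `k ≤ l`) of the linearized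
forward-Euler DG scheme for an interface shock: its characteristic polynomial is
`(X - 1)^{p+1}`, so `1` is the only eigenvalue with algebraic multiplicity
`p + 1`, while `ker (T - I)` is one-dimensional, i.e. the eigenvalue `1` has
geometric multiplicity `1`. -/
theorem stmt18 (p : ℕ) (hp : 1 ≤ p) (c : ℝ) (hc : c ≠ 0)
    (T : Matrix (Fin (p+1)) (Fin (p+1)) ℝ)
    (hT : T = Matrix.of fun k l : Fin (p+1) =>
      (if k = l then (1 : ℝ) else 0) +
        c * (2 * (k : ℕ) + 1) *
          (if (l : ℕ) < (k : ℕ) then 1 - (-1 : ℝ) ^ ((k : ℕ) + (l : ℕ)) else 0)) :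
    T.charpoly = (X - 1) ^ (p + 1) ∧
    Module.finrank ℝ (LinearMap.ker (Matrix.toLin' (T - 1))) = 1 := by
  have hdiag : ∀ i j, i ≤ j → (T - 1) i j = 0 := by
    intro i j hij
    simp [hT, Matrix.one_apply, hij.not_gt]
  have hsub : ∀ i : Fin p, (T - 1) i.succ i.castSucc ≠ 0 := by
    intro i
    have hodd : (-1 : ℝ) ^ ((i : ℕ) + 1 + i) = -1 := Odd.neg_one_pow ⟨i, by ring⟩
    have hpos : (2 * ((i : ℝ) + 1) + 1) ≠ 0 := by positivity
    simp [hT, Matrix.one_apply, hodd, hc, hpos]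
  constructor
  · have hupper : T.transpose.IsUpperTriangular := by
      intro i j hij
      have hij : j < i := hij
      have h := hdiag j i hij.le
      rw [Matrix.sub_apply, Matrix.one_apply_ne hij.ne, sub_zero] at h
      exact h
    have hone : ∀ i, T i i = 1 := by
      intro i
      have h := hdiag i i le_rfl
      rwa [Matrix.sub_apply, Matrix.one_apply_eq, sub_eq_zero] at h
    rw [← Matrix.charpoly_transpose, Matrix.charpoly_of_isUpperTriangular _ hupper]
    simp [hone]
  · rw [Matrix.ker_toLin'_eq_span_of_subdiag_ne_zero hdiag hsub]
    exact finrank_span_singleton (by simp)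
end
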